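/- arXiv:2109.06722 — 5 statements merged into one kernel-verified Lean document; each statement's English description precedes it below -/
import Mathlib

section
/- Let A be a commutative ℝ-algebra, let n be a positive natural number, let λ be a nonzero real number, and let a, b ∈ A satisfy a^(n+1) = 0 and b^(n+1) = 0. Then 2 · (a + b)^(2n-1) · (λ • a + λ⁻¹ • b) = (λ + λ⁻¹) • (a + b)^(2n). -/
/-- If `a ^ (m + 2) = 0 = b ^ (m + 2)`, only the two central terms of the binomial expansion of
`(a + b) ^ (2 * m + 1)` survive. -/
theorem add_pow_two_mul_add_one_of_pow_eq_zero {R : Type*} [CommSemiring R] (m : ℕ) (a b : R)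
    (ha : a ^ (m + 2) = 0) (hb : b ^ (m + 2) = 0) :
    (a + b) ^ (2 * m + 1) =
      ((2 * m + 1).choose m : R) * (a ^ m * b ^ (m + 1) + a ^ (m + 1) * b ^ m) := by
  have hsub : ({m, m + 1} : Finset ℕ) ⊆ Finset.range (2 * m + 1 + 1) := by
    intro i hi
    simp only [Finset.mem_insert, Finset.mem_singleton] at hi
    simp only [Finset.mem_range]
    omega
  rw [add_pow, ← Finset.sum_subset hsub, Finset.sum_pair (by omega),
    Nat.choose_symm_half, show 2 * m + 1 - m = m + 1 by omega,
    show 2 * m + 1 - (m + 1) = m by omega]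
  · ring
  · intro i _ hi
    simp only [Finset.mem_insert, Finset.mem_singleton, not_or] at hi
    rcases Nat.lt_or_ge i m with h | h
    · rw [pow_eq_zero_of_le (by omega : m + 2 ≤ 2 * m + 1 - i) hb]
      simp
    · rw [pow_eq_zero_of_le (by omega : m + 2 ≤ i) ha]
      simp

/-- In a commutative `ℝ`-algebra, if `a^(n+1) = 0` and `b^(n+1) = 0` and `λ ≠ 0`, then
`2 (a+b)^(2n-1) (λ•a + λ⁻¹•b) = (λ + λ⁻¹) • (a+b)^(2n)`. -/
theorem stmt1 {A : Type*} [CommRing A] [Algebra ℝ A] (n : ℕ) (hn : 0 < n)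
    (lam : ℝ) (hlam : lam ≠ 0) (a b : A)
    (ha : a ^ (n + 1) = 0) (hb : b ^ (n + 1) = 0) :
    2 * ((a + b) ^ (2 * n - 1) * (lam • a + lam⁻¹ • b)) =
      (lam + lam⁻¹) • (a + b) ^ (2 * n) := by
  obtain ⟨m, rfl⟩ := Nat.exists_eq_add_of_lt hn
  simp only [zero_add] at ha hb ⊢
  rw [show 2 * (m + 1) - 1 = 2 * m + 1 by omega, show 2 * (m + 1) = 2 * m + 1 + 1 by omega,
    pow_succ (a + b) (2 * m + 1), add_pow_two_mul_add_one_of_pow_eq_zero m a b ha hb]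
  simp only [Algebra.smul_def, map_add]
  generalize algebraMap ℝ A lam = x
  generalize algebraMap ℝ A lam⁻¹ = y
  generalize ((2 * m + 1).choose m : A) = c
  linear_combination c * (x - y) * (b ^ m * ha - a ^ m * hb)
end

section
/- Let A be a commutative ℝ-algebra, let m be a positive natural number, let β₁, …, β_m ∈ A satisfy βᵢ² = 0 for every i, and let a₁, …, a_m be real numbers. Then m · (β₁ + ⋯ + β_m)^(m-1) · (a₁ • β₁ + ⋯ + a_m • β_m) = (a₁ + ⋯ + a_m) • (β₁ + ⋯ + β_m)^m. -/
/-- Multiplication by a square-zero element `b` kills the contribution of `b` to a power. -/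
theorem mul_add_pow_of_sq_eq_zero {A : Type*} [CommRing A] {b : A} (hb : b ^ 2 = 0) (t : A)
    (n : ℕ) : b * (b + t) ^ n = b * t ^ n := by
  induction n with
  | zero => simp
  | succ n ih =>
    linear_combination (b + t) * ih + t ^ n * hb

theorem mul_sum_pow_of_sq_eq_zero {ι A : Type*} [DecidableEq ι] [CommRing A] {β : ι → A}
    (hβ : ∀ i, β i ^ 2 = 0) {s : Finset ι} {i : ι} (hi : i ∈ s) (n : ℕ) :
    β i * (∑ j ∈ s, β j) ^ n = β i * (∑ j ∈ s.erase i, β j) ^ n := by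
  rw [← Finset.add_sum_erase s β hi, mul_add_pow_of_sq_eq_zero (hβ i)]

/-- The top power of a sum of square-zero elements. -/
theorem sum_pow_card_of_sq_eq_zero {ι A : Type*} [DecidableEq ι] [CommRing A] {β : ι → A}
    (hβ : ∀ i, β i ^ 2 = 0) (n : ℕ) (s : Finset ι) (hs : s.card = n) :
    (∑ i ∈ s, β i) ^ n = n.factorial * ∏ i ∈ s, β i := by
  induction n generalizing s with
  | zero => simp [Finset.card_eq_zero.mp hs]
  | succ n ih =>
    have h : ∀ i ∈ s, β i * (∑ j ∈ s, β j) ^ n = n.factorial * ∏ j ∈ s, β j := by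
      intro i hi
      rw [mul_sum_pow_of_sq_eq_zero hβ hi, ih _ (by simp [Finset.card_erase_of_mem hi, hs]),
        ← Finset.mul_prod_erase s β hi]
      ring
    rw [pow_succ', Finset.sum_mul, Finset.sum_congr rfl h, Finset.sum_const, hs, nsmul_eq_mul,
      Nat.factorial_succ]
    push_cast
    ring

/-- In a commutative `ℝ`-algebra, if `βᵢ² = 0` for all `i`, then
`m (∑βᵢ)^(m-1) (∑ aᵢ•βᵢ) = (∑aᵢ) • (∑βᵢ)^m`. -/
theorem stmt2 {A : Type*} [CommRing A] [Algebra ℝ A] (m : ℕ) (hm : 0 < m)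
    (β : Fin m → A) (hβ : ∀ i, β i ^ 2 = 0) (a : Fin m → ℝ) :
    (m : A) * ((∑ i, β i) ^ (m - 1) * (∑ i, a i • β i)) =
      (∑ i, a i) • (∑ i, β i) ^ m := by
  have h : ∀ i, (m : A) * ((∑ j, β j) ^ (m - 1) * β i) = (∑ j, β j) ^ m := by
    intro i
    rw [mul_comm (_ ^ _), mul_sum_pow_of_sq_eq_zero hβ (Finset.mem_univ i),
      sum_pow_card_of_sq_eq_zero hβ (m - 1) _ (by simp),
      sum_pow_card_of_sq_eq_zero hβ m _ (by simp),
      ← Finset.mul_prod_erase _ β (Finset.mem_univ i), ← Nat.mul_factorial_pred hm.ne']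
    push_cast
    ring
  simp_rw [Finset.mul_sum, mul_smul_comm, h, Finset.sum_smul]
end

section
/- Let (Ω, μ) be a probability space, let a ≥ 0 be a real number, and let g : Ω → ℝ be measurable such that g, (g − a)², and cosh ∘ g are all integrable with respect to μ. If ∫ g dμ ≥ a, then ∫ cosh(g) dμ ≥ cosh(a) + (1/2) ∫ (g − a)² dμ. -/
open MeasureTheory

/-- The function `cosh` lies above its tangent line at `a` plus half the squared distance. -/
theorem cosh_add_sinh_mul_add_sq_le (a x : ℝ) :
    Real.cosh a + Real.sinh a * (x - a) + (1 / 2) * (x - a) ^ 2 ≤ Real.cosh x := by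
  have hderiv (y : ℝ) : HasDerivAt (fun y => Real.cosh y - y ^ 2 / 2) (Real.sinh y - y) y := by
    refine ((Real.hasDerivAt_cosh y).fun_sub ((hasDerivAt_pow 2 y).div_const 2)).congr_deriv ?_
    simp
  have hconv : ConvexOn ℝ Set.univ (fun y : ℝ => Real.cosh y - y ^ 2 / 2) := by
    refine Monotone.convexOn_univ_of_deriv (fun y => (hderiv y).differentiableAt) ?_
    rw [funext fun y => (hderiv y).deriv]
    exact Real.sinh_sub_id_strictMono.monotone
  rcases lt_trichotomy a x with h | rfl | h
  · have := hconv.le_slope_of_hasDerivAt (Set.mem_univ a) (Set.mem_univ x) h (hderiv a)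
    rw [slope_def_field, le_div_iff₀ (sub_pos.2 h)] at this
    linarith
  · simp
  · have := hconv.slope_le_of_hasDerivAt (Set.mem_univ x) (Set.mem_univ a) h (hderiv a)
    rw [slope_def_field, div_le_iff₀ (sub_pos.2 h)] at this
    linarith

/-- Quantitative Jensen-type inequality for `cosh` over a probability space. -/
theorem stmt4 {Ω : Type*} [MeasurableSpace Ω] (μ : Measure Ω) [IsProbabilityMeasure μ]
    (a : ℝ) (ha : 0 ≤ a) (g : Ω → ℝ) (hmeas : Measurable g)
    (hg : Integrable g μ) (hg2 : Integrable (fun x => (g x - a) ^ 2) μ)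
    (hgc : Integrable (fun x => Real.cosh (g x)) μ)
    (hmean : a ≤ ∫ x, g x ∂μ) :
    Real.cosh a + (1 / 2) * ∫ x, (g x - a) ^ 2 ∂μ ≤ ∫ x, Real.cosh (g x) ∂μ := by
  have hlin : Integrable (fun x => Real.sinh a * (g x - a)) μ :=
    (hg.sub (integrable_const a)).const_mul _
  have hsq : Integrable (fun x => (1 / 2) * (g x - a) ^ 2) μ := hg2.const_mul _
  have haff : Integrable (fun x => Real.cosh a + Real.sinh a * (g x - a)) μ :=
    (integrable_const _).add hlin
  have hmono := integral_mono (haff.add hsq) hgc fun x => cosh_add_sinh_mul_add_sq_le a (g x)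
  have heq : ∫ x, Real.cosh a + Real.sinh a * (g x - a) + (1 / 2) * (g x - a) ^ 2 ∂μ =
      Real.cosh a + Real.sinh a * (∫ x, g x ∂μ - a) + (1 / 2) * ∫ x, (g x - a) ^ 2 ∂μ := by
    rw [integral_add haff hsq, integral_add (integrable_const _) hlin, integral_const_mul,
      integral_const_mul, integral_sub hg (integrable_const a)]
    simp
  have hnonneg : 0 ≤ Real.sinh a * (∫ x, g x ∂μ - a) :=
    mul_nonneg (Real.sinh_nonneg_iff.2 ha) (sub_nonneg.2 hmean)
  simp only [Pi.add_apply] at hmono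
  linarith
end

section
/- Let (Ω, μ) be a probability space, let a ≥ 0 be a real number, and for each k ∈ ℕ let g_k : Ω → ℝ be measurable with g_k, (g_k − a)², and cosh ∘ g_k integrable. Suppose ∫ g_k dμ ≥ a for every k, and ∫ cosh(g_k) dμ → cosh(a) as k → ∞. Then ∫ (g_k − a)² dμ → 0 as k → ∞. -/
open MeasureTheory Filter

/-- The second-order lower bound for `cosh` at `a`, coming from the convexity of
`x ↦ cosh x - x ^ 2 / 2`. -/
theorem Real.cosh_add_sinh_mul_add_sq_div_two_le_cosh (a x : ℝ) :
    Real.cosh a + Real.sinh a * (x - a) + (x - a) ^ 2 / 2 ≤ Real.cosh x := by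
  have hderiv (y : ℝ) : HasDerivAt (fun y => Real.cosh y - y ^ 2 / 2) (Real.sinh y - y) y := by
    refine ((Real.hasDerivAt_cosh y).sub ((hasDerivAt_pow 2 y).div_const 2)).congr_deriv ?_
    simp
  have hconv : ConvexOn ℝ Set.univ (fun y => Real.cosh y - y ^ 2 / 2) := by
    refine Monotone.convexOn_univ_of_deriv (fun y => (hderiv y).differentiableAt) ?_
    rw [funext fun y => (hderiv y).deriv]
    exact Real.sinh_sub_id_strictMono.monotone
  rcases lt_trichotomy x a with h | rfl | h
  · have := hconv.slope_le_of_hasDerivAt (Set.mem_univ x) (Set.mem_univ a) h (hderiv a)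
    rw [slope_def_field, div_le_iff₀ (sub_pos.2 h)] at this
    linarith
  · simp
  · have := hconv.le_slope_of_hasDerivAt (Set.mem_univ a) (Set.mem_univ x) h (hderiv a)
    rw [slope_def_field, le_div_iff₀ (sub_pos.2 h)] at this
    linarith

/-- If `∫ gₖ ≥ a ≥ 0` and `∫ cosh(gₖ) → cosh a`, then the variance-type
integrals `∫ (gₖ - a)²` tend to `0`. -/
theorem stmt5 {Ω : Type*} [MeasurableSpace Ω] (μ : Measure Ω) [IsProbabilityMeasure μ]
    (a : ℝ) (ha : 0 ≤ a) (g : ℕ → Ω → ℝ) (hmeas : ∀ k, Measurable (g k))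
    (hint : ∀ k, Integrable (g k) μ)
    (hint2 : ∀ k, Integrable (fun x => (g k x - a) ^ 2) μ)
    (hintc : ∀ k, Integrable (fun x => Real.cosh (g k x)) μ)
    (hmean : ∀ k, a ≤ ∫ x, g k x ∂μ)
    (hcosh : Tendsto (fun k => ∫ x, Real.cosh (g k x) ∂μ) atTop (nhds (Real.cosh a))) :
    Tendsto (fun k => ∫ x, (g k x - a) ^ 2 ∂μ) atTop (nhds 0) := by
  have hlim : Tendsto (fun k => 2 * (∫ x, Real.cosh (g k x) ∂μ - Real.cosh a)) atTop (nhds 0) := by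
    simpa using (hcosh.sub_const (Real.cosh a)).const_mul 2
  refine squeeze_zero (fun k => integral_nonneg fun x => sq_nonneg _) (fun k => ?_) hlim
  have hlin : Integrable (fun x => Real.sinh a * (g k x - a)) μ :=
    ((hint k).sub (integrable_const a)).const_mul _
  have haff : Integrable (fun x => Real.cosh a + Real.sinh a * (g k x - a)) μ :=
    (integrable_const _).add hlin
  have hle := integral_mono (haff.add ((hint2 k).div_const 2)) (hintc k)
    fun x => Real.cosh_add_sinh_mul_add_sq_div_two_le_cosh a (g k x)
  simp only [Pi.add_apply] at hle
  rw [integral_add haff ((hint2 k).div_const 2), integral_add (integrable_const _) hlin,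
    integral_const_mul, integral_sub (hint k) (integrable_const a), integral_div] at hle
  simp only [integral_const, probReal_univ, one_smul] at hle
  have := mul_nonneg (Real.sinh_nonneg_iff.2 ha) (sub_nonneg.2 (hmean k))
  linarith
end

section
/- Let (Ω, μ) be a probability space, let f : Ω → Ω be measurable and measure-preserving, let c ≥ 0 be real, and for each N ≥ 1 let g_N : Ω → ℝ be an integrable nonnegative function. Suppose (i) g_{N+M}(x) ≤ g_N(x) + g_M(f^[N](x)) for all N, M ≥ 1 and all x ∈ Ω, and (ii) for μ-almost every x, liminf_{N→∞} g_N(x)/N ≥ c. Then ∫ g_N dμ ≥ N·c for every N ≥ 1. -/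
open MeasureTheory Filter

/-- The integrals of a sequence of functions that is subadditive along orbits satisfy
`∫ g_{(k+1)N} ≤ (k+1) ∫ g_N`. -/
theorem integral_mul_le_of_subadditive_along_orbits {Ω : Type*} [MeasurableSpace Ω]
    {μ : Measure Ω} {f : Ω → Ω} (hf : MeasurePreserving f μ μ) {g : ℕ → Ω → ℝ}
    (hint : ∀ N : ℕ, 1 ≤ N → Integrable (g N) μ)
    (hsub : ∀ N M : ℕ, 1 ≤ N → 1 ≤ M → ∀ x, g (N + M) x ≤ g N x + g M (f^[N] x))
    {N : ℕ} (hN : 1 ≤ N) (k : ℕ) :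
    ∫ x, g ((k + 1) * N) x ∂μ ≤ (k + 1) * ∫ x, g N x ∂μ := by
  induction k with
  | zero => simp
  | succ k ih =>
    have hk : 1 ≤ (k + 1) * N := Nat.mul_pos k.succ_pos hN
    have hmp := hf.iterate ((k + 1) * N)
    have hcomp : Integrable (fun x => g N (f^[(k + 1) * N] x)) μ :=
      hmp.integrable_comp_of_integrable (hint N hN)
    have hcomp_eq : ∫ x, g N (f^[(k + 1) * N] x) ∂μ = ∫ x, g N x ∂μ := by
      conv_rhs => rw [← hmp.map_eq]
      rw [integral_map hmp.measurable.aemeasurable]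
      rw [hmp.map_eq]
      exact (hint N hN).aestronglyMeasurable
    have hle : ∫ x, g ((k + 1 + 1) * N) x ∂μ
        ≤ ∫ x, (g ((k + 1) * N) x + g N (f^[(k + 1) * N] x)) ∂μ := by
      refine integral_mono (hint _ (Nat.mul_pos (k + 1).succ_pos hN))
        ((hint _ hk).add hcomp) fun x => ?_
      rw [Nat.succ_mul (k + 1) N]
      exact hsub _ _ hk hN x
    rw [integral_add (hint _ hk) hcomp, hcomp_eq] at hle
    push_cast
    linarith

/-- Fatou + Fekete argument: if the nonnegative integrable functions `g_N` are
subadditive along orbits of a measure-preserving map and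
`liminf g_N(x)/N ≥ c` almost everywhere, then `∫ g_N ≥ N c` for every `N ≥ 1`. -/
theorem stmt16 {Ω : Type*} [MeasurableSpace Ω] (μ : Measure Ω) [IsProbabilityMeasure μ]
    (f : Ω → Ω) (hf : MeasurePreserving f μ μ)
    (c : ℝ) (hc : 0 ≤ c) (g : ℕ → Ω → ℝ)
    (hint : ∀ N : ℕ, 1 ≤ N → Integrable (g N) μ)
    (hpos : ∀ N : ℕ, 1 ≤ N → ∀ x, 0 ≤ g N x)
    (hsub : ∀ N M : ℕ, 1 ≤ N → 1 ≤ M → ∀ x, g (N + M) x ≤ g N x + g M (f^[N] x))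
    (hlim : ∀ᵐ x ∂μ, c ≤ liminf (fun N : ℕ => g N x / N) atTop) :
    ∀ N : ℕ, 1 ≤ N → (N : ℝ) * c ≤ ∫ x, g N x ∂μ := by
  intro N hN
  have hN0 : (0 : ℝ) < N := by exact_mod_cast hN
  have hI : 0 ≤ ∫ x, g N x ∂μ := integral_nonneg (hpos N hN)
  suffices h : c ≤ (∫ x, g N x ∂μ) / N by
    rwa [le_div_iff₀ hN0, mul_comm] at h
  refine le_of_forall_lt_imp_le_of_dense fun a ha => ?_
  let n : ℕ → ℕ := fun k => (k + 1) * N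
  have hn : ∀ k, 1 ≤ n k := fun k => Nat.mul_pos k.succ_pos hN
  have hn_tendsto : Tendsto n atTop atTop :=
    tendsto_atTop_mono (fun k => k.le_succ.trans (Nat.le_mul_of_pos_right _ hN)) tendsto_id
  let h : ℕ → Ω → ENNReal := fun k x => ENNReal.ofReal (g (n k) x / n k)
  have hliminf : ∀ᵐ x ∂μ, ENNReal.ofReal a ≤ liminf (fun k => h k x) atTop := by
    filter_upwards [hlim] with x hx
    have hbdd : IsBoundedUnder (· ≥ ·) atTop (fun N : ℕ => g N x / N) := by
      refine isBoundedUnder_of_eventually_ge (a := 0) ?_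
      filter_upwards [eventually_ge_atTop 1] with m hm
      exact div_nonneg (hpos m hm x) m.cast_nonneg
    have hev := hn_tendsto.eventually (eventually_lt_of_lt_liminf (ha.trans_le hx) hbdd)
    exact le_liminf_of_le (by isBoundedDefault)
      (hev.mono fun k hk => ENNReal.ofReal_le_ofReal hk.le)
  have hlintegral : ∀ k, ∫⁻ x, h k x ∂μ ≤ ENNReal.ofReal ((∫ x, g N x ∂μ) / N) := by
    intro k
    rw [← ofReal_integral_eq_lintegral_ofReal ((hint _ (hn k)).div_const _)
      (Eventually.of_forall fun x => div_nonneg (hpos _ (hn k) x) (Nat.cast_nonneg _)),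
      integral_div]
    refine ENNReal.ofReal_le_ofReal ?_
    have hk := integral_mul_le_of_subadditive_along_orbits hf hint hsub hN k
    rw [div_le_div_iff₀ (by exact_mod_cast hn k) hN0]
    calc (∫ x, g (n k) x ∂μ) * N ≤ ((k + 1) * ∫ x, g N x ∂μ) * N := by gcongr
      _ = (∫ x, g N x ∂μ) * (n k : ℕ) := by simp only [n]; push_cast; ring
  have hfatou : ENNReal.ofReal a ≤ ENNReal.ofReal ((∫ x, g N x ∂μ) / N) :=
    calc ENNReal.ofReal a = ∫⁻ _, ENNReal.ofReal a ∂μ := by simp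
      _ ≤ ∫⁻ x, liminf (fun k => h k x) atTop ∂μ := lintegral_mono_ae hliminf
      _ ≤ liminf (fun k => ∫⁻ x, h k x ∂μ) atTop :=
        lintegral_liminf_le' fun k =>
          ((hint _ (hn k)).aestronglyMeasurable.aemeasurable.div_const _).ennreal_ofReal
      _ ≤ liminf (fun _ : ℕ => ENNReal.ofReal ((∫ x, g N x ∂μ) / N)) atTop :=
        liminf_le_liminf (Eventually.of_forall hlintegral)
      _ = ENNReal.ofReal ((∫ x, g N x ∂μ) / N) := liminf_const _
  exact (ENNReal.ofReal_le_ofReal_iff (div_nonneg hI hN0.le)).1 hfatou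
end
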